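/- Let q = 1 and for each σ_w > 0 let σ̄ = σ̄(σ_w) be the unique positive solution of σ̄² = σ_w² + (1/δ)·min_{χ ≥ 0} E[(η_1(B + σ̄Z; χ) − B)²]. If δ > M_1(ε), then lim_{σ_w → 0} σ_w²/σ̄(σ_w)² = (δ − M_1(ε))/δ. -/

import Mathlib

open MeasureTheory ProbabilityTheory Real Filter Set

noncomputable section

/-- The standard Gaussian measure on `ℝ`. -/
def stdGaussian : Measure ℝ := gaussianReal 0 1

/-- Soft thresholding, i.e. `η₁(u;χ) = sign(u)·max(|u|−χ,0)`. -/
def soft (u χ : ℝ) : ℝ := Real.sign u * max (|u| - χ) 0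

/-- `M₁(ε) = inf_{χ ≥ 0} [(1−ε)·E[η₁(Z;χ)²] + ε(1+χ²)]`, `Z ~ N(0,1)`. -/
def M1 (ε : ℝ) : ℝ :=
  ⨅ χ : NNReal, ((1 - ε) * ∫ z, (soft z (χ:ℝ))^2 ∂stdGaussian + ε * (1 + (χ:ℝ)^2))

/-- The law of `B`: the mixture `(1−ε)δ₀ + ε·g`. -/
def mix (ε : ℝ) (g : Measure ℝ) : Measure ℝ :=
  ENNReal.ofReal (1 - ε) • Measure.dirac (0:ℝ) + ENNReal.ofReal ε • g

/-- `min_{χ ≥ 0} E[(η(B+σZ;χ) − B)²]` where `B ~ μB`, `Z ~ N(0,1)` independent. -/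
def riskMin (η : ℝ → ℝ → ℝ) (μB : Measure ℝ) (σ : ℝ) : ℝ :=
  ⨅ χ : NNReal, ∫ b, (∫ z, (η (b + σ * z) (χ:ℝ) - b)^2 ∂stdGaussian) ∂μB

instance : IsProbabilityMeasure stdGaussian := by
  unfold _root_.stdGaussian; infer_instance

/-- Projection of `u` onto `[-τ, τ]`. -/
def clamp (τ u : ℝ) : ℝ := max (-τ) (min τ u)

lemma clamp_le {τ : ℝ} (hτ : 0 ≤ τ) (u : ℝ) : clamp τ u ≤ τ :=
  max_le (by linarith) (min_le_left _ _)

lemma neg_le_clamp (τ u : ℝ) : -τ ≤ clamp τ u := le_max_left _ _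

lemma clamp_mono (τ : ℝ) : Monotone (clamp τ) := fun _ _ h =>
  max_le_max le_rfl (min_le_min le_rfl h)

lemma continuous_clamp (τ : ℝ) : Continuous (clamp τ) := by
  unfold clamp; fun_prop

lemma sq_clamp_le {τ : ℝ} (hτ : 0 ≤ τ) (u : ℝ) : clamp τ u ^ 2 ≤ τ ^ 2 :=
  sq_le_sq' (neg_le_clamp τ u) (clamp_le hτ u)

lemma clamp_eq_of_le {τ u : ℝ} (hτ : 0 ≤ τ) (h : τ ≤ u) : clamp τ u = τ := by
  rw [clamp, min_eq_left h, max_eq_right (by linarith)]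

lemma clamp_eq_neg_of_le {τ u : ℝ} (h : u ≤ -τ) : clamp τ u = -τ :=
  max_eq_left ((min_le_right _ _).trans h)

lemma soft_eq_sub_clamp {τ : ℝ} (hτ : 0 ≤ τ) (u : ℝ) : soft u τ = u - clamp τ u := by
  unfold soft
  rcases lt_trichotomy u 0 with h | h | h
  · rw [Real.sign_of_neg h, abs_of_neg h]
    rcases le_total u (-τ) with h' | h'
    · rw [clamp_eq_neg_of_le h', max_eq_left (by linarith)]; ring
    · rw [clamp, min_eq_right (by linarith), max_eq_right h', max_eq_right (by linarith)]; ring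
  · subst h
    have : clamp τ 0 = 0 := by rw [clamp, min_eq_right hτ, max_eq_right (by linarith)]
    simp [this]
  · rw [Real.sign_of_pos h, abs_of_pos h]
    rcases le_total τ u with h' | h'
    · rw [clamp_eq_of_le hτ h', max_eq_left (by linarith)]; ring
    · rw [clamp, min_eq_right h', max_eq_right (by linarith), max_eq_right (by linarith)]; ring

lemma soft_scale {σ τ : ℝ} (hσ : 0 < σ) (u : ℝ) : soft (σ * u) (σ * τ) = σ * soft u τ := by
  have hs : Real.sign (σ * u) = Real.sign u := by
    rcases lt_trichotomy u 0 with h | h | h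
    · rw [Real.sign_of_neg h, Real.sign_of_neg (mul_neg_of_pos_of_neg hσ h)]
    · simp [h]
    · rw [Real.sign_of_pos h, Real.sign_of_pos (mul_pos hσ h)]
  unfold soft
  rw [hs, abs_mul, abs_of_pos hσ, ← mul_sub, ← mul_zero σ, ← mul_max_of_nonneg _ _ hσ.le, mul_zero]
  ring

lemma memLp_id_stdGaussian : MemLp id 2 stdGaussian := memLp_id_gaussianReal 2

lemma integrable_sq_stdGaussian : Integrable (fun z : ℝ => z ^ 2) stdGaussian :=
  memLp_id_stdGaussian.integrable_sq

lemma integrable_id_stdGaussian : Integrable (fun z : ℝ => z) stdGaussian :=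
  memLp_id_stdGaussian.integrable (by norm_num)

lemma integral_id_stdGaussian : ∫ z, z ∂stdGaussian = 0 := integral_id_gaussianReal

lemma integral_sq_stdGaussian : ∫ z, z ^ 2 ∂stdGaussian = 1 := by
  have h := variance_id_gaussianReal (μ := 0) (v := 1)
  rw [variance_eq_integral measurable_id.aemeasurable] at h
  simpa [_root_.stdGaussian] using h

/-- Risk of soft thresholding at level `τ` for the signal `μ` in standard Gaussian noise. -/
def softRisk (τ μ : ℝ) : ℝ := ∫ z, (soft (μ + z) τ - μ) ^ 2 ∂stdGaussian

lemma softRisk_eq {τ : ℝ} (hτ : 0 ≤ τ) (μ : ℝ) :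
    softRisk τ μ = ∫ z, (z - clamp τ (μ + z)) ^ 2 ∂stdGaussian := by
  unfold softRisk
  congr 1; ext z
  rw [soft_eq_sub_clamp hτ]; ring

lemma softRisk_nonneg (τ μ : ℝ) : 0 ≤ softRisk τ μ := integral_nonneg fun _ => sq_nonneg _

lemma integrable_sq_sub_clamp {τ : ℝ} (hτ : 0 ≤ τ) (μ : ℝ) :
    Integrable (fun z => (z - clamp τ (μ + z)) ^ 2) stdGaussian := by
  refine ((integrable_sq_stdGaussian.const_mul 2).add (integrable_const (2 * τ ^ 2))).mono'
    (Continuous.aestronglyMeasurable ?_) (ae_of_all _ fun z => ?_)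
  · have := continuous_clamp τ
    fun_prop
  · rw [Real.norm_eq_abs, abs_of_nonneg (sq_nonneg _)]
    simp only [Pi.add_apply]
    nlinarith [sq_clamp_le hτ (μ + z), sq_nonneg (z + clamp τ (μ + z))]

lemma softRisk_le {τ : ℝ} (hτ : 0 ≤ τ) (μ : ℝ) : softRisk τ μ ≤ 1 + τ ^ 2 := by
  rw [softRisk_eq hτ]
  have i2 := integrable_id_stdGaussian.const_mul (-2 * clamp τ μ)
  have i1 : Integrable (fun z => z ^ 2 + -2 * clamp τ μ * z) stdGaussian :=
    integrable_sq_stdGaussian.add i2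
  calc ∫ z, (z - clamp τ (μ + z)) ^ 2 ∂stdGaussian
      ≤ ∫ z, (z ^ 2 + -2 * clamp τ μ * z + τ ^ 2) ∂stdGaussian := by
        refine integral_mono (integrable_sq_sub_clamp hτ μ) (i1.add (integrable_const _))
          fun z => ?_
        have hm : 0 ≤ z * (clamp τ (μ + z) - clamp τ μ) := by
          rcases le_total 0 z with h | h
          · exact mul_nonneg h (sub_nonneg.2 (clamp_mono τ (by linarith)))
          · exact mul_nonneg_of_nonpos_of_nonpos h (sub_nonpos.2 (clamp_mono τ (by linarith)))
        have := sq_clamp_le hτ (μ + z)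
        simp only
        nlinarith
    _ = 1 + τ ^ 2 := by
        rw [integral_add i1 (integrable_const _), integral_add integrable_sq_stdGaussian i2,
          integral_const_mul, integral_id_stdGaussian, integral_sq_stdGaussian]
        simp

lemma clamp_of_abs_le {τ T μ z : ℝ} (hτ : 0 ≤ τ) (hτT : τ ≤ T) (h : |z| ≤ |μ| - T) :
    clamp τ (μ + z) = (if 0 ≤ μ then 1 else -1) * τ := by
  have h1 := neg_abs_le z
  have h2 := le_abs_self z
  split_ifs with hμ
  · rw [abs_of_nonneg hμ] at h
    rw [clamp_eq_of_le hτ (by linarith), one_mul]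
  · rw [abs_of_neg (not_le.1 hμ)] at h
    rw [clamp_eq_neg_of_le (by linarith)]; ring

/-- Numerator of the error made by replacing the soft thresholding risk by its limit. -/
def softErr (T z : ℝ) : ℝ := (T ^ 2 + 4 * T * |z|) * (|z| + T + 1)

lemma softErr_nonneg {T : ℝ} (hT : 0 ≤ T) (z : ℝ) : 0 ≤ softErr T z := by
  unfold softErr; positivity

lemma le_softErr_div {T μ z : ℝ} (hT : 0 ≤ T) (h : |μ| - T < |z|) :
    T ^ 2 + 4 * T * |z| ≤ softErr T z / (|μ| + 1) := by
  rw [le_div_iff₀ (by positivity)]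
  exact mul_le_mul_of_nonneg_left (by linarith) (by positivity)

lemma integrable_softErr (T : ℝ) : Integrable (softErr T) stdGaussian := by
  have h := ((integrable_sq_stdGaussian.const_mul (4 * T)).add
    (integrable_id_stdGaussian.abs.const_mul (5 * T ^ 2 + 4 * T))).add
      (integrable_const (T ^ 2 * (T + 1)))
  refine h.congr (ae_of_all _ fun z => ?_)
  simp only [Pi.add_apply, softErr]
  rw [← sq_abs z]; ring

lemma sq_sub_clamp_ge_of_le {τ T : ℝ} (hτ : 0 ≤ τ) (hτT : τ ≤ T) (μ z : ℝ) :
    z ^ 2 + τ ^ 2 + (-2 * ((if 0 ≤ μ then 1 else -1) * τ)) * z - softErr T z / (|μ| + 1) ≤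
      (z - clamp τ (μ + z)) ^ 2 := by
  have hT := hτ.trans hτT
  rcases le_or_gt |z| (|μ| - T) with h | h
  · rw [clamp_of_abs_le hτ hτT h]
    have : 0 ≤ softErr T z / (|μ| + 1) := div_nonneg (softErr_nonneg hT z) (by positivity)
    have hs : ((if 0 ≤ μ then 1 else -1 : ℝ)) ^ 2 = 1 := by split_ifs <;> norm_num
    have : ((if 0 ≤ μ then 1 else -1) * τ) ^ 2 = τ ^ 2 := by rw [mul_pow, hs, one_mul]
    nlinarith
  · have h1 := le_softErr_div hT h
    have h2 : |z * clamp τ (μ + z)| ≤ |z| * T := by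
      rw [abs_mul]
      exact mul_le_mul_of_nonneg_left
        (abs_le.2 ⟨by linarith [neg_le_clamp τ (μ + z)], (clamp_le hτ _).trans hτT⟩) (abs_nonneg z)
    have h3 : |z * ((if 0 ≤ μ then 1 else -1) * τ)| ≤ |z| * T := by
      rw [abs_mul]
      refine mul_le_mul_of_nonneg_left (abs_le.2 ?_) (abs_nonneg z)
      split_ifs <;> constructor <;> linarith
    have h4 : τ ^ 2 ≤ T ^ 2 := by gcongr
    nlinarith [(abs_le.1 h2).2, (abs_le.1 h3).1, sq_nonneg (clamp τ (μ + z))]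

lemma sq_sub_clamp_ge_of_ge {τ T : ℝ} (hT : 0 ≤ T) (hτT : T ≤ τ) (μ z : ℝ) :
    T ^ 2 / 2 - z ^ 2 - softErr T z / (|μ| + 1) ≤ (z - clamp τ (μ + z)) ^ 2 := by
  have h0 : clamp τ (μ + z) ^ 2 / 2 - z ^ 2 ≤ (z - clamp τ (μ + z)) ^ 2 := by
    nlinarith [sq_nonneg (2 * z - clamp τ (μ + z))]
  have h1 : 0 ≤ softErr T z / (|μ| + 1) := div_nonneg (softErr_nonneg hT z) (by positivity)
  rcases le_or_gt |z| (|μ| - T) with h | h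
  · have h2 : T ^ 2 ≤ clamp τ (μ + z) ^ 2 := by
      have hmono : T ≤ |clamp τ (μ + z)| := by
        have ha := neg_abs_le z
        have hb := le_abs_self z
        rcases le_total 0 μ with hμ | hμ
        · rw [abs_of_nonneg hμ] at h
          exact (le_max_of_le_right (le_min hτT (by linarith))).trans (le_abs_self _)
        · rw [abs_of_nonpos hμ] at h
          refine le_trans ?_ (neg_le_abs _)
          have : clamp τ (μ + z) ≤ -T :=
            max_le (by linarith) ((min_le_right _ _).trans (by linarith))
          linarith
      rw [← sq_abs (clamp τ (μ + z))]
      gcongr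
    linarith
  · have := le_softErr_div hT h
    have : 0 ≤ 4 * T * |z| := by positivity
    nlinarith [sq_nonneg z, sq_nonneg (z - clamp τ (μ + z)), sq_nonneg T]

lemma softRisk_ge_of_le {τ T : ℝ} (hτ : 0 ≤ τ) (hτT : τ ≤ T) (μ : ℝ) :
    1 + τ ^ 2 - (∫ z, softErr T z ∂stdGaussian) * (|μ| + 1)⁻¹ ≤ softRisk τ μ := by
  rw [softRisk_eq hτ]
  have i1 := integrable_sq_stdGaussian.add (integrable_const (μ := stdGaussian) (τ ^ 2))
  have i2 := integrable_id_stdGaussian.const_mul (-2 * ((if 0 ≤ μ then 1 else -1) * τ))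
  have i3 := (integrable_softErr T).div_const (|μ| + 1)
  have h := integral_mono ((i1.add i2).sub i3) (integrable_sq_sub_clamp hτ μ)
    (sq_sub_clamp_ge_of_le hτ hτT μ)
  refine le_trans (le_of_eq ?_) h
  rw [integral_sub' (i1.add i2) i3, integral_add' i1 i2,
    integral_add' integrable_sq_stdGaussian (integrable_const _),
    integral_const_mul, integral_id_stdGaussian, integral_sq_stdGaussian, integral_div]
  simp [div_eq_mul_inv]

lemma softRisk_ge_of_ge {τ T : ℝ} (hT : 0 ≤ T) (hτT : T ≤ τ) (μ : ℝ) :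
    T ^ 2 / 2 - 1 - (∫ z, softErr T z ∂stdGaussian) * (|μ| + 1)⁻¹ ≤ softRisk τ μ := by
  have hτ := hT.trans hτT
  rw [softRisk_eq hτ]
  have i1 := (integrable_const (μ := stdGaussian) (T ^ 2 / 2)).sub integrable_sq_stdGaussian
  have i3 := (integrable_softErr T).div_const (|μ| + 1)
  have h := integral_mono (i1.sub i3) (integrable_sq_sub_clamp hτ μ)
    (sq_sub_clamp_ge_of_ge hT hτT μ)
  refine le_trans (le_of_eq ?_) h
  rw [integral_sub' i1 i3, integral_sub' (integrable_const _) integrable_sq_stdGaussian,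
    integral_sq_stdGaussian, integral_div (|μ| + 1)]
  simp [div_eq_mul_inv]

lemma stronglyMeasurable_softRisk {τ : ℝ} (hτ : 0 ≤ τ) : StronglyMeasurable (softRisk τ) := by
  have h : softRisk τ = fun μ => ∫ z, (z - clamp τ (μ + z)) ^ 2 ∂stdGaussian :=
    funext (softRisk_eq hτ)
  rw [h]
  have hc : Continuous (fun p : ℝ × ℝ => (p.2 - clamp τ (p.1 + p.2)) ^ 2) := by
    have := continuous_clamp τ
    fun_prop
  exact hc.stronglyMeasurable.integral_prod_right

lemma integrable_softRisk_div (ν : Measure ℝ) [IsFiniteMeasure ν] {τ : ℝ} (hτ : 0 ≤ τ) (σ : ℝ) :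
    Integrable (fun b => softRisk τ (b / σ)) ν := by
  refine (integrable_const (1 + τ ^ 2)).mono'
    ((stronglyMeasurable_softRisk hτ).comp_measurable
      (measurable_id.div_const σ)).aestronglyMeasurable (ae_of_all _ fun b => ?_)
  rw [Real.norm_eq_abs, abs_of_nonneg (softRisk_nonneg _ _)]
  exact softRisk_le hτ _

/-- The risk under the mixture, in units of the noise level `σ`. -/
def scaledRisk (ε : ℝ) (g : Measure ℝ) (σ τ : ℝ) : ℝ :=
  (1 - ε) * softRisk τ 0 + ε * ∫ b, softRisk τ (b / σ) ∂g

lemma integral_mix {ε : ℝ} (hε : ε ∈ Ioo (0:ℝ) 1) (g : Measure ℝ) {f : ℝ → ℝ}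
    (hf : Integrable f g) : ∫ b, f b ∂(mix ε g) = (1 - ε) * f 0 + ε * ∫ b, f b ∂g := by
  unfold mix
  rw [integral_add_measure ((integrable_dirac (by simp)).smul_measure ENNReal.ofReal_ne_top)
    (hf.smul_measure ENNReal.ofReal_ne_top), integral_smul_measure, integral_smul_measure,
    integral_dirac, ENNReal.toReal_ofReal (by linarith [hε.2]), ENNReal.toReal_ofReal hε.1.le]
  simp

lemma risk_eq_scaledRisk {ε : ℝ} (hε : ε ∈ Ioo (0:ℝ) 1) (g : Measure ℝ) [IsFiniteMeasure g]
    {σ τ : ℝ} (hσ : 0 < σ) (hτ : 0 ≤ τ) :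
    ∫ b, (∫ z, (soft (b + σ * z) (σ * τ) - b) ^ 2 ∂stdGaussian) ∂(mix ε g) =
      σ ^ 2 * scaledRisk ε g σ τ := by
  have h : ∀ b, ∫ z, (soft (b + σ * z) (σ * τ) - b) ^ 2 ∂stdGaussian =
      σ ^ 2 * softRisk τ (b / σ) := by
    intro b
    unfold softRisk
    rw [← integral_const_mul]
    congr 1; ext z
    have : b + σ * z = σ * (b / σ + z) := by field_simp
    rw [this, soft_scale hσ, ← mul_pow, mul_sub, mul_div_cancel₀ b hσ.ne']
  simp_rw [h]
  rw [integral_const_mul, integral_mix hε g (integrable_softRisk_div g hτ σ), zero_div]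
  rfl

lemma softRisk_zero (τ : ℝ) : softRisk τ 0 = ∫ z, (soft z τ) ^ 2 ∂stdGaussian := by
  simp [softRisk]

lemma bddBelow_M1 {ε : ℝ} (hε : ε ∈ Ioo (0:ℝ) 1) : BddBelow (range fun χ : NNReal =>
    ((1 - ε) * ∫ z, (soft z (χ:ℝ)) ^ 2 ∂stdGaussian + ε * (1 + (χ:ℝ) ^ 2))) := by
  refine ⟨0, ?_⟩
  rintro _ ⟨χ, rfl⟩
  have h1 : 0 ≤ ∫ z, (soft z (χ:ℝ)) ^ 2 ∂stdGaussian := integral_nonneg fun _ => sq_nonneg _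
  have := hε.1
  have : 0 ≤ 1 - ε := by linarith [hε.2]
  positivity

lemma M1_le {ε : ℝ} (hε : ε ∈ Ioo (0:ℝ) 1) {τ : ℝ} (hτ : 0 ≤ τ) :
    M1 ε ≤ (1 - ε) * softRisk τ 0 + ε * (1 + τ ^ 2) := by
  rw [softRisk_zero]
  exact ciInf_le (bddBelow_M1 hε) ⟨τ, hτ⟩

lemma M1_le_one {ε : ℝ} (hε : ε ∈ Ioo (0:ℝ) 1) : M1 ε ≤ 1 := by
  have h := M1_le hε le_rfl
  have h' := softRisk_le le_rfl 0
  nlinarith [hε.2]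

lemma scaledRisk_le {ε : ℝ} (hε : ε ∈ Ioo (0:ℝ) 1) (g : Measure ℝ) [IsProbabilityMeasure g]
    (σ : ℝ) {τ : ℝ} (hτ : 0 ≤ τ) :
    scaledRisk ε g σ τ ≤ (1 - ε) * softRisk τ 0 + ε * (1 + τ ^ 2) := by
  unfold scaledRisk
  have h := integral_mono (integrable_softRisk_div g hτ σ) (integrable_const (1 + τ ^ 2))
    fun b => softRisk_le hτ (b / σ)
  have h' : ∫ b, softRisk τ (b / σ) ∂g ≤ 1 + τ ^ 2 := by simpa using h
  have := mul_le_mul_of_nonneg_left h' hε.1.le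
  linarith

lemma riskMin_le {ε : ℝ} (hε : ε ∈ Ioo (0:ℝ) 1) (g : Measure ℝ) [IsProbabilityMeasure g]
    {σ : ℝ} (hσ : 0 < σ) : riskMin soft (mix ε g) σ ≤ σ ^ 2 * M1 ε := by
  rw [mul_comm, ← div_le_iff₀ (by positivity)]
  refine le_ciInf fun χ => ?_
  rw [div_le_iff₀ (by positivity), mul_comm, ← softRisk_zero]
  refine le_trans ?_ (mul_le_mul_of_nonneg_left (scaledRisk_le hε g σ χ.2) (sq_nonneg σ))
  refine le_of_le_of_eq ?_ (risk_eq_scaledRisk hε g hσ χ.2)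
  refine ciInf_le ⟨0, ?_⟩ (⟨σ * χ, mul_nonneg hσ.le χ.2⟩ : NNReal)
  rintro _ ⟨χ, rfl⟩
  exact integral_nonneg fun _ => integral_nonneg fun _ => sq_nonneg _

lemma integrable_inv_abs_div (g : Measure ℝ) [IsFiniteMeasure g] (σ : ℝ) :
    Integrable (fun b => (|b / σ| + 1)⁻¹) g := by
  refine (integrable_const (1:ℝ)).mono' (by fun_prop) (ae_of_all _ fun b => ?_)
  rw [Real.norm_eq_abs, abs_of_nonneg (by positivity)]
  exact inv_le_one_of_one_le₀ (by linarith [abs_nonneg (b / σ)])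

lemma integral_const_sub_inv (g : Measure ℝ) [IsProbabilityMeasure g] (σ a K : ℝ) :
    ∫ b, (a - K * (|b / σ| + 1)⁻¹) ∂g = a - K * ∫ b, (|b / σ| + 1)⁻¹ ∂g := by
  rw [integral_sub (integrable_const _) ((integrable_inv_abs_div g σ).const_mul K),
    integral_const_mul]
  simp

lemma exists_scaledRisk_ge {ε : ℝ} (hε : ε ∈ Ioo (0:ℝ) 1) (g : Measure ℝ)
    [IsProbabilityMeasure g] : ∃ K : ℝ, ∀ σ τ : ℝ, 0 ≤ τ →
      M1 ε - K * ∫ b, (|b / σ| + 1)⁻¹ ∂g ≤ scaledRisk ε g σ τ := by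
  have hε0 := hε.1
  have hε1 := hε.2
  set T : ℝ := 2 / ε with hTdef
  have hT : 0 ≤ T := by positivity
  have hTε : ε * (T ^ 2 / 2 - 1) ≥ 1 := by
    have h1 : ε * T = 2 := by rw [hTdef]; field_simp
    have h2 : 2 ≤ T := by rw [hTdef, le_div_iff₀ hε0]; linarith
    have h3 : ε * (T ^ 2 / 2 - 1) = (ε * T) * T / 2 - ε := by ring
    rw [h3, h1]; linarith
  refine ⟨ε * ∫ z, softErr T z ∂stdGaussian, fun σ τ hτ => ?_⟩
  have key : ∀ a : ℝ, (∀ μ, a - (∫ z, softErr T z ∂stdGaussian) * (|μ| + 1)⁻¹ ≤ softRisk τ μ) →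
      ε * a - ε * (∫ z, softErr T z ∂stdGaussian) * ∫ b, (|b / σ| + 1)⁻¹ ∂g ≤
        ε * ∫ b, softRisk τ (b / σ) ∂g := by
    intro a ha
    have h := integral_mono ((integrable_const a).sub
      ((integrable_inv_abs_div g σ).const_mul (∫ z, softErr T z ∂stdGaussian)))
      (integrable_softRisk_div g hτ σ) fun b => ha (b / σ)
    have h' := mul_le_mul_of_nonneg_left
      ((integral_const_sub_inv g σ a _).symm.le.trans h) hε0.le
    linarith
  unfold scaledRisk
  rcases le_total τ T with h | h
  · have := key _ (softRisk_ge_of_le hτ h)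
    have := M1_le hε hτ
    linarith
  · have := key _ (softRisk_ge_of_ge hT h)
    have := M1_le_one hε
    have : 0 ≤ (1 - ε) * softRisk τ 0 := mul_nonneg (by linarith) (softRisk_nonneg _ _)
    linarith

lemma tendsto_integral_inv_abs_div (g : Measure ℝ) [IsFiniteMeasure g] (hg0 : g {0} = 0) :
    Tendsto (fun σ => ∫ b, (|b / σ| + 1)⁻¹ ∂g) (nhdsWithin (0:ℝ) (Ioi 0)) (nhds 0) := by
  have h := tendsto_integral_filter_of_dominated_convergence (μ := g)
    (l := nhdsWithin (0:ℝ) (Ioi 0)) (F := fun σ b => (|b / σ| + 1)⁻¹) (f := fun _ => (0:ℝ))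
    (fun _ => (1:ℝ)) (Eventually.of_forall fun σ => (integrable_inv_abs_div g σ).1)
    (Eventually.of_forall fun σ => ae_of_all _ fun b => by
      rw [Real.norm_eq_abs, abs_of_nonneg (by positivity)]
      exact inv_le_one_of_one_le₀ (by linarith [abs_nonneg (b / σ)]))
    (integrable_const _) ?_
  · simpa using h
  · have hne : ∀ᵐ b ∂g, b ≠ 0 := by
      rw [ae_iff]; simpa using hg0
    filter_upwards [hne] with b hb
    refine tendsto_inv_atTop_zero.comp (tendsto_atTop_add_const_right _ _ ?_)
    have h1 : Tendsto (fun σ : ℝ => |b| * σ⁻¹) (nhdsWithin (0:ℝ) (Ioi 0)) atTop :=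
      tendsto_inv_nhdsGT_zero.const_mul_atTop (abs_pos.2 hb)
    refine h1.congr' ?_
    filter_upwards [self_mem_nhdsWithin] with σ hσ
    rw [abs_div, abs_of_pos (mem_Ioi.1 hσ), div_eq_mul_inv]

lemma tendsto_riskMin_div {ε : ℝ} (hε : ε ∈ Ioo (0:ℝ) 1) (g : Measure ℝ)
    [IsProbabilityMeasure g] (hg0 : g {0} = 0) :
    Tendsto (fun σ => riskMin soft (mix ε g) σ / σ ^ 2) (nhdsWithin (0:ℝ) (Ioi 0))
      (nhds (M1 ε)) := by
  obtain ⟨K, hK⟩ := exists_scaledRisk_ge hε g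
  have hlow : Tendsto (fun σ => M1 ε - K * ∫ b, (|b / σ| + 1)⁻¹ ∂g)
      (nhdsWithin (0:ℝ) (Ioi 0)) (nhds (M1 ε)) := by
    simpa using ((tendsto_integral_inv_abs_div g hg0).const_mul K).const_sub (M1 ε)
  refine tendsto_of_tendsto_of_tendsto_of_le_of_le' hlow tendsto_const_nhds ?_ ?_
  · filter_upwards [self_mem_nhdsWithin] with σ hσ
    have hσ : 0 < σ := hσ
    rw [le_div_iff₀ (by positivity), mul_comm]
    refine le_ciInf fun χ => ?_
    have hχ : (χ : ℝ) = σ * (χ / σ) := by field_simp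
    have hτ : 0 ≤ (χ : ℝ) / σ := div_nonneg χ.2 hσ.le
    rw [hχ, risk_eq_scaledRisk hε g hσ hτ]
    exact mul_le_mul_of_nonneg_left (hK σ _ hτ) (sq_nonneg σ)
  · filter_upwards [self_mem_nhdsWithin] with σ hσ
    have hσ : 0 < σ := hσ
    rw [div_le_iff₀ (by positivity), mul_comm]
    exact riskMin_le hε g hσ

/-- For `q = 1`, with `σb σ_w = σ̄(σ_w)` the unique positive solution of
`σ̄² = σ_w² + (1/δ)·min_{χ≥0}E[(η₁(B+σ̄Z;χ)−B)²]`, if `δ > M₁(ε)` then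
`σ_w²/σ̄(σ_w)² → (δ−M₁(ε))/δ` as `σ_w → 0⁺`. -/
theorem sigma_bar_ratio_limit
    (δ ε : ℝ) (hδ0 : 0 < δ) (hδ : M1 ε < δ) (hε : ε ∈ Ioo (0:ℝ) 1)
    (g : Measure ℝ) [IsProbabilityMeasure g] (hg0 : g {0} = 0)
    (hG2 : Integrable (fun x => x^2) g)
    (σb : ℝ → ℝ)
    (hσb : ∀ s, 0 < s → 0 < σb s ∧
      (σb s) ^ 2 = s ^ 2 + (1/δ) * riskMin soft (mix ε g) (σb s)) :
    Tendsto (fun s => s ^ 2 / (σb s) ^ 2) (nhdsWithin (0:ℝ) (Ioi 0))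
      (nhds ((δ - M1 ε) / δ)) := by
  have hσ0 : Tendsto σb (nhdsWithin (0:ℝ) (Ioi 0)) (nhdsWithin (0:ℝ) (Ioi 0)) := by
    have hd : 0 < δ - M1 ε := sub_pos.2 hδ
    refine tendsto_nhdsWithin_iff.2 ⟨?_, ?_⟩
    · have hup : Tendsto (fun s : ℝ => √(δ / (δ - M1 ε)) * s) (nhdsWithin (0:ℝ) (Ioi 0))
          (nhds 0) := by
        have : Continuous fun s : ℝ => √(δ / (δ - M1 ε)) * s := by fun_prop
        simpa using (this.tendsto 0).mono_left nhdsWithin_le_nhds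
      refine tendsto_of_tendsto_of_tendsto_of_le_of_le' tendsto_const_nhds hup ?_ ?_
      · filter_upwards [self_mem_nhdsWithin] with s hs
        exact (hσb s hs).1.le
      · filter_upwards [self_mem_nhdsWithin] with s hs
        have hs : 0 < s := hs
        obtain ⟨h1, h2⟩ := hσb s hs
        have h3 := riskMin_le hε g h1
        refine le_of_sq_le_sq ?_ (by positivity)
        rw [mul_pow, Real.sq_sqrt (by positivity), div_mul_eq_mul_div, le_div_iff₀ hd]
        have h4 : δ * σb s ^ 2 = δ * s ^ 2 + riskMin soft (mix ε g) (σb s) := by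
          rw [h2]; field_simp
        linarith
    · filter_upwards [self_mem_nhdsWithin] with s hs
      exact (hσb s hs).1
  have hlim := (((tendsto_riskMin_div hε g hg0).comp hσ0).div_const δ).const_sub 1
  have hval : 1 - M1 ε / δ = (δ - M1 ε) / δ := by field_simp
  rw [hval] at hlim
  refine hlim.congr' ?_
  filter_upwards [self_mem_nhdsWithin] with s hs
  obtain ⟨h1, h2⟩ := hσb s hs
  have h5 : s ^ 2 = σb s ^ 2 - 1 / δ * riskMin soft (mix ε g) (σb s) := by linarith
  rw [h5, Function.comp_apply]
  field_simp
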